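/- arXiv:2311.14366 — 2 statements merged into one kernel-verified Lean document; each statement's English description precedes it below -/
import Mathlib

section
/- Let s ∈ ℝ and b > 1/2. There exists a constant C depending only on b such that for every τ ∈ (0,1] and every sequence (u_n)_{n∈ℤ} of functions on T², ‖u_n‖_{X^{s,−b}_τ} ≤ C τ Σ_{n∈ℤ} ‖u_n‖_{H^s(T²)}, with C independent of τ (this is the norm inequality ‖u_n‖_{X^{s,−b}_τ} ≤ C ‖u_n‖_{l¹_τ H^s}). -/
noncomputable section

open MeasureTheory
open scoped Real BigOperators ENNReal NNReal

namespace NLS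

/-- A fundamental domain `[0,2π]²` for the torus `T² = (ℝ/2πℤ)²`. -/
def box : Set (ℝ × ℝ) := Set.Icc 0 (2*π) ×ˢ Set.Icc 0 (2*π)

/-- The character `e^{i⟨k,x⟩}` on the torus. -/
def eK (k : ℤ × ℤ) (x : ℝ × ℝ) : ℂ :=
  Complex.exp (Complex.I * ((k.1 : ℂ) * (x.1 : ℂ) + (k.2 : ℂ) * (x.2 : ℂ)))

/-- Fourier coefficient `û(k) = (1/(4π²)) ∫_{T²} u(x) e^{-i⟨k,x⟩} dx`. -/
def fCoeff (u : ℝ × ℝ → ℂ) (k : ℤ × ℤ) : ℂ :=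
  (4*π^2 : ℝ)⁻¹ • ∫ x in box, u x * (starRingEnd ℂ) (eK k x)

/-- `|k|² = k₁² + k₂²` for `k ∈ ℤ²`. -/
def sqAbs (k : ℤ × ℤ) : ℝ := (k.1 : ℝ)^2 + (k.2 : ℝ)^2

/-- The Sobolev `H^s(T²)` norm `(Σ_k ⟨k⟩^{2s} |û(k)|²)^{1/2}`. -/
def hNorm (s : ℝ) (u : ℝ × ℝ → ℂ) : ℝ≥0∞ :=
  (∑' k : ℤ × ℤ, ENNReal.ofReal ((1 + sqAbs k) ^ s) * (‖fCoeff u k‖₊ : ℝ≥0∞)^2) ^ ((1:ℝ)/2)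

/-- The `L²(T²)` norm `(Σ_k |û(k)|²)^{1/2}`. -/
def l2Norm (u : ℝ × ℝ → ℂ) : ℝ≥0∞ :=
  (∑' k : ℤ × ℤ, (‖fCoeff u k‖₊ : ℝ≥0∞)^2) ^ ((1:ℝ)/2)

/-- The frequency projection `Π_θ`: keeps the Fourier modes `k ∈ [-θ^{-1/2}, θ^{-1/2})²`. -/
def proj (θ : ℝ) (u : ℝ × ℝ → ℂ) : ℝ × ℝ → ℂ := fun x =>
  ∑' k : ℤ × ℤ,
    Set.indicator {k : ℤ × ℤ |
        -θ ^ (-(1:ℝ)/2) ≤ (k.1 : ℝ) ∧ (k.1 : ℝ) < θ ^ (-(1:ℝ)/2) ∧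
        -θ ^ (-(1:ℝ)/2) ≤ (k.2 : ℝ) ∧ (k.2 : ℝ) < θ ^ (-(1:ℝ)/2)}
      (fun k => fCoeff u k * eK k x) k

/-- The free Schrödinger flow `e^{itΔ}`, as a Fourier multiplier `e^{-it|k|²}`. -/
def flow (t : ℝ) (u : ℝ × ℝ → ℂ) : ℝ × ℝ → ℂ := fun x =>
  ∑' k : ℤ × ℤ, Complex.exp (-Complex.I * (t : ℂ) * (sqAbs k : ℂ)) * fCoeff u k * eK k x

/-- Time-space Fourier transform `ũ(σ,k) = ∫_ℝ ∫_{T²} u e^{-iσt-i⟨k,x⟩} dx dt`. -/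
def tsFT (u : ℝ × (ℝ × ℝ) → ℂ) (σ : ℝ) (k : ℤ × ℤ) : ℂ :=
  ∫ t : ℝ, (∫ x in box, u (t, x) * (starRingEnd ℂ) (eK k x)) *
    Complex.exp (-Complex.I * (σ : ℂ) * (t : ℂ))

/-- The Bourgain norm `‖u‖_{X^{s,b}}`. -/
def xNorm (s b : ℝ) (u : ℝ × (ℝ × ℝ) → ℂ) : ℝ≥0∞ :=
  (∫⁻ σ : ℝ, ∑' k : ℤ × ℤ,
      ENNReal.ofReal ((1 + sqAbs k) ^ s * (1 + (σ + sqAbs k)^2) ^ b) *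
        (‖tsFT u σ k‖₊ : ℝ≥0∞)^2) ^ ((1:ℝ)/2)

/-- The localized Bourgain norm `‖u‖_{X^{s,b}(I)}` (infimum over extensions). -/
def xNormOn (s b : ℝ) (I : Set ℝ) (u : ℝ × (ℝ × ℝ) → ℂ) : ℝ≥0∞ :=
  ⨅ (v : ℝ × (ℝ × ℝ) → ℂ) (_ : ∀ t ∈ I, ∀ x : ℝ × ℝ, v (t, x) = u (t, x)), xNorm s b v

/-- `d_τ(σ) = (e^{iτσ} - 1)/τ`. -/
def dlin (τ σ : ℝ) : ℂ := (Complex.exp (Complex.I * (τ : ℂ) * (σ : ℂ)) - 1) / (τ : ℂ)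

/-- Time-space Fourier transform of a sequence: `ũ(σ,k) = τ Σ_m û_m(k) e^{imτσ}`. -/
def dtsFT (τ : ℝ) (u : ℤ → ℝ × ℝ → ℂ) (σ : ℝ) (k : ℤ × ℤ) : ℂ :=
  (τ : ℂ) * ∑' m : ℤ, fCoeff (u m) k * Complex.exp (Complex.I * (m : ℂ) * (τ : ℂ) * (σ : ℂ))

/-- The discrete Bourgain norm `‖u_n‖_{X^{s,b}_τ}`. -/
def dxNorm (τ s b : ℝ) (u : ℤ → ℝ × ℝ → ℂ) : ℝ≥0∞ :=
  (∫⁻ σ in Set.Ioo (-(π/τ)) (π/τ), ∑' k : ℤ × ℤ,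
      ENNReal.ofReal ((1 + sqAbs k) ^ s * (1 + ‖dlin τ (σ - sqAbs k)‖^2) ^ b) *
        (‖dtsFT τ u σ k‖₊ : ℝ≥0∞)^2) ^ ((1:ℝ)/2)

/-- Grid indices `{-N/2, …, N/2 - 1}`. -/
def gridIdx (N : ℕ) : Finset ℤ := Finset.Icc (-(N : ℤ)/2) ((N : ℤ)/2 - 1)

/-- The grid points `x_{jl} = (2πj/N, 2πl/N)`. -/
def gridPt (N : ℕ) (j l : ℤ) : ℝ × ℝ := (2*π*(j : ℝ)/(N : ℝ), 2*π*(l : ℝ)/(N : ℝ))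

/-- The two-dimensional discrete Fourier transform `F_N`. -/
def dft (N : ℕ) (u : ℝ × ℝ → ℂ) (k : ℤ × ℤ) : ℂ :=
  ∑ j₁ ∈ gridIdx N, ∑ j₂ ∈ gridIdx N,
    u (gridPt N j₁ j₂) *
      Complex.exp (-(2 * (π : ℂ) * Complex.I) * ((k.1 : ℂ) * (j₁ : ℂ) + (k.2 : ℂ) * (j₂ : ℂ)) / (N : ℂ))

/-- The trigonometric interpolation operator `T_N`. -/
def interp (N : ℕ) (u : ℝ × ℝ → ℂ) : ℝ × ℝ → ℂ := fun x =>
  ((N : ℂ)^2)⁻¹ * ∑ k₁ ∈ gridIdx N, ∑ k₂ ∈ gridIdx N, dft N u (k₁, k₂) * eK (k₁, k₂) x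

/-- The `l⁴_τ L⁴(T²)` norm of a sequence, with normalized measure on `T²`. -/
def l4l4Norm (τ : ℝ) (u : ℤ → ℝ × ℝ → ℂ) : ℝ≥0∞ :=
  (ENNReal.ofReal τ * ∑' n : ℤ,
      (ENNReal.ofReal (4*π^2))⁻¹ * ∫⁻ x in box, (‖u n x‖₊ : ℝ≥0∞)^4) ^ ((1:ℝ)/4)

lemma norm_dlin (τ σ : ℝ) (hτ : 0 < τ) : ‖dlin τ σ‖ = 2 * |Real.sin (τ * σ / 2)| / τ := by
  unfold dlin
  have h := Complex.norm_exp_I_mul_ofReal_sub_one (τ * σ)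
  push_cast at h
  rw [norm_div, mul_assoc, h]
  simp [abs_of_pos hτ]

lemma periodic_dlin (τ : ℝ) (hτ : 0 < τ) : Function.Periodic (dlin τ) (2 * (π / τ)) := by
  intro x
  unfold dlin
  have hτ' : (τ : ℂ) ≠ 0 := by exact_mod_cast hτ.ne'
  have : Complex.I * (τ : ℂ) * ((x + 2 * (π / τ) : ℝ) : ℂ)
      = Complex.I * (τ : ℂ) * (x : ℂ) + 2 * π * Complex.I := by
    push_cast
    field_simp
  rw [this, Complex.exp_periodic]

lemma continuous_dlin (τ : ℝ) : Continuous (dlin τ) := by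
  unfold dlin
  fun_prop

lemma continuous_wt (τ b : ℝ) : Continuous (fun σ => (1 + ‖dlin τ σ‖^2) ^ (-b)) := by
  have h1 : Continuous (fun σ => 1 + ‖dlin τ σ‖^2) :=
    continuous_const.add ((continuous_dlin τ).norm.pow 2)
  exact h1.rpow_const (fun σ => Or.inl (by positivity))

lemma wt_le (τ b σ : ℝ) (hτ : 0 < τ) (hb : 0 < b) (hσ : |σ| ≤ π / τ) :
    (1 + ‖dlin τ σ‖^2) ^ (-b) ≤ ((2/π)^2) ^ (-b) * (1 + ‖σ‖^2) ^ (-(2*b)/2) := by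
  have hpi := Real.pi_pos
  have h1 : 2 / π * |τ * σ / 2| ≤ |Real.sin (τ * σ / 2)| := by
    apply Real.mul_abs_le_abs_sin
    rw [abs_div, abs_mul, abs_of_pos hτ, abs_two]
    rw [le_div_iff₀ hτ] at hσ
    nlinarith
  have h2 : 2 / π * |σ| ≤ ‖dlin τ σ‖ := by
    rw [norm_dlin τ σ hτ, le_div_iff₀ hτ]
    rw [abs_div, abs_mul, abs_of_pos hτ, abs_two] at h1
    nlinarith
  have h3 : (2/π)^2 ≤ 1 := by
    have : 2/π ≤ 1 := by
      rw [div_le_one hpi]; linarith [Real.pi_gt_three]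
    have h0 : 0 ≤ 2/π := by positivity
    nlinarith
  rw [show -(2*b)/2 = -b by ring, ← Real.mul_rpow (by positivity) (by positivity)]
  apply Real.rpow_le_rpow_of_nonpos (by positivity) _ (by linarith)
  have h4 : (2 / π * |σ|)^2 ≤ ‖dlin τ σ‖^2 := by gcongr
  rw [Real.norm_eq_abs]
  nlinarith

lemma lintegral_wt (b : ℝ) (hb : 1/2 < b) : ∃ K : ℝ, 0 < K ∧ ∀ τ : ℝ, 0 < τ → ∀ c : ℝ,
    ∫⁻ σ in Set.Ioo (-(π/τ)) (π/τ), ENNReal.ofReal ((1 + ‖dlin τ (σ - c)‖^2) ^ (-b))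
      ≤ ENNReal.ofReal K := by
  have hint : Integrable (fun x : ℝ => (1 + ‖x‖^2) ^ (-(2*b)/2)) :=
    integrable_rpow_neg_one_add_norm_sq (by simp; linarith)
  refine ⟨((2/π)^2) ^ (-b) * (∫ x : ℝ, (1 + ‖x‖^2) ^ (-(2*b)/2)) + 1, ?_, ?_⟩
  · have : 0 ≤ ∫ x : ℝ, (1 + ‖x‖^2) ^ (-(2*b)/2) := integral_nonneg (fun x => by positivity)
    positivity
  intro τ hτ c
  have hpt : 0 < π / τ := by positivity
  have hle : -(π/τ) ≤ π/τ := by linarith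
  have hc := continuous_wt τ b
  have hc' : Continuous (fun σ => (1 + ‖dlin τ (σ - c)‖^2) ^ (-b)) :=
    hc.comp (continuous_id.sub continuous_const)
  have hper : Function.Periodic (fun σ => (1 + ‖dlin τ σ‖^2) ^ (-b)) (2 * (π / τ)) := by
    intro x
    simp only [periodic_dlin τ hτ x]
  rw [← ofReal_integral_eq_lintegral_ofReal]
  rotate_left
  · exact (hc'.integrableOn_Icc (a := -(π/τ)) (b := π/τ)).mono_set Set.Ioo_subset_Icc_self
  · exact Filter.Eventually.of_forall (fun x => by positivity)
  apply ENNReal.ofReal_le_ofReal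
  rw [← integral_Ioc_eq_integral_Ioo, ← intervalIntegral.integral_of_le hle,
    intervalIntegral.integral_comp_sub_right (fun σ => (1 + ‖dlin τ σ‖^2) ^ (-b)) c]
  have e1 := hper.intervalIntegral_add_eq (-(π/τ) - c) (-(π/τ))
  rw [show -(π/τ) - c + 2 * (π/τ) = π/τ - c by ring,
    show -(π/τ) + 2 * (π/τ) = π/τ by ring] at e1
  rw [e1, intervalIntegral.integral_of_le hle, ← integral_const_mul]
  have hint2 := hint.const_mul (((2/π)^2) ^ (-b))
  have : ∫ x in Set.Ioc (-(π/τ)) (π/τ), (1 + ‖dlin τ x‖^2) ^ (-b) ≤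
      ∫ x in Set.Ioc (-(π/τ)) (π/τ), ((2/π)^2) ^ (-b) * (1 + ‖x‖^2) ^ (-(2*b)/2) := by
    apply setIntegral_mono_on
    · exact (hc.integrableOn_Icc (a := -(π/τ)) (b := π/τ)).mono_set Set.Ioc_subset_Icc_self
    · exact hint2.integrableOn
    · exact measurableSet_Ioc
    · intro x hx
      exact wt_le τ b x hτ (by linarith) (abs_le.2 ⟨hx.1.le, hx.2⟩)
  have h2 := setIntegral_le_integral (s := Set.Ioc (-(π/τ)) (π/τ)) hint2
    (Filter.Eventually.of_forall (fun x => by positivity))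
  linarith

/-- Cauchy-Schwarz for weighted sums. -/
lemma tsum_cs (w f g : ℤ × ℤ → ℝ≥0∞) :
    ∑' k, w k * (f k * g k) ≤
      (∑' k, w k * f k ^ 2) ^ ((1:ℝ)/2) * (∑' k, w k * g k ^ 2) ^ ((1:ℝ)/2) := by
  have h := ENNReal.lintegral_mul_le_Lp_mul_Lq (Measure.count : Measure (ℤ × ℤ))
    (p := 2) (q := 2) (Real.HolderConjugate.two_two)
    (f := fun k => w k ^ ((1:ℝ)/2) * f k) (g := fun k => w k ^ ((1:ℝ)/2) * g k)
    (Measurable.of_discrete.aemeasurable) (Measurable.of_discrete.aemeasurable)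
  simp only [lintegral_count, Pi.mul_apply] at h
  have hw : ∀ x : ℝ≥0∞, x ^ ((1:ℝ)/2) * x ^ ((1:ℝ)/2) = x := by
    intro x
    rw [← ENNReal.rpow_add_of_nonneg _ _ (by norm_num) (by norm_num)]
    norm_num
  have e : ∀ x y : ℝ≥0∞, (x ^ ((1:ℝ)/2) * y) ^ (2:ℝ) = x * y ^ 2 := by
    intro x y
    rw [ENNReal.rpow_two, mul_pow, sq (x ^ _), hw]
  simp only [e] at h
  refine le_trans (le_of_eq ?_) h
  congr 1; ext k
  calc w k * (f k * g k) = (w k ^ ((1:ℝ)/2) * w k ^ ((1:ℝ)/2)) * (f k * g k) := by rw [hw]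
    _ = _ := by ring

/-- Minkowski. -/
lemma tsum_mink (w : ℤ × ℤ → ℝ≥0∞) (a : ℤ → ℤ × ℤ → ℝ≥0∞) :
    ∑' k, w k * (∑' m, a m k) ^ 2 ≤ (∑' m, (∑' k, w k * a m k ^ 2) ^ ((1:ℝ)/2)) ^ 2 := by
  calc ∑' k, w k * (∑' m, a m k) ^ 2 = ∑' k, ∑' m, ∑' n, w k * (a m k * a n k) := by
        congr 1; ext k
        rw [sq, ← ENNReal.tsum_mul_right, ← ENNReal.tsum_mul_left]
        congr 1; ext m
        rw [← ENNReal.tsum_mul_left, ← ENNReal.tsum_mul_left]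
    _ = ∑' m, ∑' n, ∑' k, w k * (a m k * a n k) := by
        rw [ENNReal.tsum_comm]
        congr 1; ext m
        rw [ENNReal.tsum_comm]
    _ ≤ ∑' m, ∑' n, (∑' k, w k * a m k ^ 2) ^ ((1:ℝ)/2) * (∑' k, w k * a n k ^ 2) ^ ((1:ℝ)/2) :=
        ENNReal.tsum_le_tsum fun m => ENNReal.tsum_le_tsum fun n => tsum_cs _ _ _
    _ = _ := by
        simp only [ENNReal.tsum_mul_left, ENNReal.tsum_mul_right]
        rw [sq]

lemma dtsFT_le (τ : ℝ) (hτ : 0 < τ) (u : ℤ → ℝ × ℝ → ℂ) (σ : ℝ) (k : ℤ × ℤ) :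
    (‖dtsFT τ u σ k‖₊ : ℝ≥0∞) ≤ ENNReal.ofReal τ * ∑' m, (‖fCoeff (u m) k‖₊ : ℝ≥0∞) := by
  unfold dtsFT
  simp only [← enorm_eq_nnnorm]
  rw [enorm_mul]
  have h1 : ‖(τ:ℂ)‖ₑ = ENNReal.ofReal τ := by
    rw [← ofReal_norm, Complex.norm_real, Real.norm_of_nonneg hτ.le]
  rw [h1]
  gcongr
  refine enorm_tsum_le_tsum_enorm.trans (ENNReal.tsum_le_tsum fun m => ?_)
  rw [enorm_mul]
  have h2 : ‖Complex.exp (Complex.I * (m : ℂ) * (τ : ℂ) * (σ : ℂ))‖ₑ = 1 := by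
    rw [← ofReal_norm]
    have := Complex.norm_exp_I_mul_ofReal (m * τ * σ)
    push_cast at this
    rw [mul_assoc, mul_assoc, ← mul_assoc (m : ℂ), this]
    simp
  rw [h2, mul_one]

/-- dual embedding `l¹_τ H^s ↪ X^{s,-b}_τ` for `b > 1/2`. -/
theorem stmt7 (b : ℝ) (hb : 1/2 < b) :
    ∃ C : ℝ, 0 < C ∧ ∀ s : ℝ, ∀ τ : ℝ, τ ∈ Set.Ioc (0:ℝ) 1 →
      ∀ u : ℤ → ℝ × ℝ → ℂ,
        dxNorm τ s (-b) u ≤ ENNReal.ofReal C * (ENNReal.ofReal τ * ∑' n : ℤ, hNorm s (u n)) := by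
  obtain ⟨K, hK, hKb⟩ := lintegral_wt b hb
  refine ⟨K ^ ((1:ℝ)/2), by positivity, ?_⟩
  intro s τ hτ u
  have hτ0 := hτ.1
  set w : ℤ × ℤ → ℝ≥0∞ := fun k => ENNReal.ofReal ((1 + sqAbs k) ^ s) with hw
  set A : ℤ × ℤ → ℝ≥0∞ := fun k => ∑' m, (‖fCoeff (u m) k‖₊ : ℝ≥0∞) with hA
  have hsq : ∀ k, 0 ≤ sqAbs k := fun k => by unfold sqAbs; positivity
  have hmain : (∫⁻ σ in Set.Ioo (-(π/τ)) (π/τ), ∑' k : ℤ × ℤ,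
      ENNReal.ofReal ((1 + sqAbs k) ^ s * (1 + ‖dlin τ (σ - sqAbs k)‖^2) ^ (-b)) *
        (‖dtsFT τ u σ k‖₊ : ℝ≥0∞)^2)
      ≤ ENNReal.ofReal K * (ENNReal.ofReal τ * ∑' n : ℤ, hNorm s (u n)) ^ 2 := by
    calc _ ≤ ∫⁻ σ in Set.Ioo (-(π/τ)) (π/τ), ∑' k : ℤ × ℤ,
          ENNReal.ofReal ((1 + ‖dlin τ (σ - sqAbs k)‖^2) ^ (-b)) *
            (w k * (ENNReal.ofReal τ * A k)^2) := by
          apply lintegral_mono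
          intro σ
          apply ENNReal.tsum_le_tsum
          intro k
          have h0 : 0 ≤ (1 + sqAbs k) ^ s := Real.rpow_nonneg (by linarith [hsq k]) _
          rw [ENNReal.ofReal_mul h0, mul_comm (ENNReal.ofReal ((1 + sqAbs k) ^ s)), mul_assoc]
          gcongr
          exact dtsFT_le τ hτ0 u σ k
      _ = ∑' k : ℤ × ℤ, (∫⁻ σ in Set.Ioo (-(π/τ)) (π/τ),
          ENNReal.ofReal ((1 + ‖dlin τ (σ - sqAbs k)‖^2) ^ (-b))) *
            (w k * (ENNReal.ofReal τ * A k)^2) := by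
          have hm : ∀ k : ℤ × ℤ, Measurable fun σ =>
              ENNReal.ofReal ((1 + ‖dlin τ (σ - sqAbs k)‖^2) ^ (-b)) := fun k =>
            (((continuous_wt τ b).comp (continuous_id.sub continuous_const)).measurable).ennreal_ofReal
          rw [lintegral_tsum]
          · congr 1; ext k
            rw [lintegral_mul_const _ (hm k)]
          · intro k
            exact ((hm k).mul_const _).aemeasurable
      _ ≤ ∑' k : ℤ × ℤ, ENNReal.ofReal K * (w k * (ENNReal.ofReal τ * A k)^2) := by
          apply ENNReal.tsum_le_tsum
          intro k
          gcongr
          exact hKb τ hτ0 _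
      _ = ENNReal.ofReal K * (ENNReal.ofReal τ ^ 2 * ∑' k, w k * A k ^ 2) := by
          rw [ENNReal.tsum_mul_left, ← ENNReal.tsum_mul_left (a := ENNReal.ofReal τ ^ 2)]
          congr 2; ext k
          ring
      _ ≤ _ := by
          rw [mul_pow]
          gcongr
          exact tsum_mink w (fun m k => (‖fCoeff (u m) k‖₊ : ℝ≥0∞))
  unfold dxNorm
  refine (ENNReal.rpow_le_rpow hmain (by norm_num)).trans (le_of_eq ?_)
  rw [ENNReal.mul_rpow_of_nonneg _ _ (by norm_num), ← ENNReal.rpow_two, ← ENNReal.rpow_mul,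
    ENNReal.ofReal_rpow_of_pos hK]
  norm_num
end NLS
end
end

section
/- Let N > 0 be an even integer, τ ∈ (0,1], θ = max(τ, 4N^{−2}), c > 0, and let m be the smallest positive integer such that (cθ)^{−1/2} ≤ mN/2. Then for every v ∈ L²(T²), the grid samples of the frequency-truncated function satisfy N^{−2} Σ_{j,l=−N/2}^{N/2−1} |(Π_{cθ} v)(x_{jl})|² ≤ m² ‖Π_{cθ} v‖²_{L²(T²)}; since m < c^{−1/2} + 1, this gives ‖(Π_{cθ}v)(x_{jl})‖_{l²_h} ≤ C_c ‖Π_{cθ}v‖_{L²} with C_c depending only on c. -/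
noncomputable section

open MeasureTheory
open scoped Real BigOperators ENNReal NNReal

namespace NLS

/-- One-dimensional exponential sum over the grid. -/
theorem grid_sum (N : ℕ) (hN : Even N) (hNpos : 0 < N) (d : ℤ) :
    ∑ j ∈ gridIdx N, Complex.exp (Complex.I * ((d : ℂ) * ((2*π*(j : ℝ)/(N : ℝ) : ℝ) : ℂ)))
      = if (N : ℤ) ∣ d then (N : ℂ) else 0 := by
  obtain ⟨h, rfl⟩ := hN
  set ω : ℂ := Complex.exp (2 * π * Complex.I * d / ((h + h : ℕ) : ℂ)) with hω
  have hN0 : ((h + h : ℕ) : ℂ) ≠ 0 := by exact_mod_cast hNpos.ne'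
  have hterm : ∀ j : ℤ, Complex.exp (Complex.I * ((d : ℂ) *
      ((2*π*(j : ℝ)/((h + h : ℕ) : ℝ) : ℝ) : ℂ))) = ω ^ j := by
    intro j
    rw [hω, ← Complex.exp_int_mul]
    congr 1
    push_cast
    ring
  simp only [hterm]
  have hω0 : ω ≠ 0 := Complex.exp_ne_zero _
  have hsum : ∑ j ∈ gridIdx (h + h), ω ^ j
      = ω ^ (-(h : ℤ)) * ∑ i ∈ Finset.range (h + h), ω ^ i := by
    rw [Finset.mul_sum]
    symm
    refine Finset.sum_bij (fun i _ => -(h : ℤ) + (i : ℤ)) ?_ ?_ ?_ ?_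
    · intro i hi
      simp only [gridIdx, Finset.mem_Icc, Finset.mem_range] at *
      push_cast
      omega
    · intro a _ b _ hab
      simpa using hab
    · intro b hb
      simp only [gridIdx, Finset.mem_Icc] at hb
      push_cast at hb
      refine ⟨(b + h).toNat, ?_, ?_⟩
      · simp only [Finset.mem_range]
        omega
      · omega
    · intro i _
      rw [zpow_add₀ hω0, zpow_natCast]
  rw [hsum]
  have hωN : ω ^ (h + h) = 1 := by
    rw [hω, ← Complex.exp_nat_mul, Complex.exp_eq_one_iff]
    refine ⟨d, ?_⟩
    field_simp
  have hone : ω = 1 ↔ ((h + h : ℕ) : ℤ) ∣ d := by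
    rw [hω, Complex.exp_eq_one_iff]
    have hpi : (2 * (π : ℂ) * Complex.I) ≠ 0 := Complex.two_pi_I_ne_zero
    constructor
    · rintro ⟨n, hn⟩
      refine ⟨n, ?_⟩
      have h1 : (2 * (π : ℂ) * Complex.I) * d = (2 * (π : ℂ) * Complex.I) *
          (((h + h : ℕ) : ℂ) * n) := by
        rw [div_eq_iff hN0] at hn
        rw [hn]; ring
      have h2 := mul_left_cancel₀ hpi h1
      exact_mod_cast h2
    · rintro ⟨n, hn⟩
      refine ⟨n, ?_⟩
      rw [hn]
      rw [div_eq_iff hN0]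
      push_cast
      ring
  split_ifs with hd
  · rw [hone.2 hd]; simp
  · have hne : ω - 1 ≠ 0 := sub_ne_zero.2 (fun hh => hd (hone.1 hh))
    have := mul_geom_sum ω (h + h)
    rw [hωN, sub_self] at this
    rw [(mul_eq_zero.1 this).resolve_left hne, mul_zero]

theorem eK_mul_conj (k k' : ℤ × ℤ) (x : ℝ × ℝ) :
    eK k x * (starRingEnd ℂ) (eK k' x)
      = Complex.exp (Complex.I * (((k.1 - k'.1 : ℤ) : ℂ) * (x.1 : ℂ))) *
        Complex.exp (Complex.I * (((k.2 - k'.2 : ℤ) : ℂ) * (x.2 : ℂ))) := by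
  unfold eK
  rw [← Complex.exp_conj, ← Complex.exp_add, ← Complex.exp_add]
  congr 1
  simp only [map_mul, map_add, Complex.conj_I, Complex.conj_ofReal, map_intCast]
  push_cast
  ring

theorem int_exp (d : ℤ) :
    ∫ x in Set.Icc 0 (2*π), Complex.exp (Complex.I * ((d : ℂ) * (x : ℂ)))
      = if d = 0 then (2 * π : ℂ) else 0 := by
  rw [integral_Icc_eq_integral_Ioc, ← intervalIntegral.integral_of_le Real.two_pi_pos.le]
  split_ifs with hd
  · subst hd
    simp
  · have hc : Complex.I * (d : ℂ) ≠ 0 :=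
      mul_ne_zero Complex.I_ne_zero (by exact_mod_cast hd)
    simp only [← mul_assoc]
    rw [integral_exp_mul_complex hc]
    have : Complex.exp (Complex.I * d * ((2 * π : ℝ) : ℂ)) = 1 := by
      rw [Complex.exp_eq_one_iff]
      exact ⟨d, by push_cast; ring⟩
    rw [this]
    simp

theorem int_eK (k k' : ℤ × ℤ) :
    ∫ x in box, eK k x * (starRingEnd ℂ) (eK k' x) = if k = k' then (4 * π^2 : ℂ) else 0 := by
  simp only [eK_mul_conj]
  unfold box
  rw [Measure.volume_eq_prod]
  rw [setIntegral_prod_mul (fun y : ℝ => Complex.exp (Complex.I * (((k.1 - k'.1 : ℤ) : ℂ) * (y : ℂ))))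
    (fun y : ℝ => Complex.exp (Complex.I * (((k.2 - k'.2 : ℤ) : ℂ) * (y : ℂ))))]
  rw [int_exp, int_exp]
  simp only [sub_eq_zero, Prod.ext_iff]
  split_ifs <;> first | (exfalso; tauto) | ring1

theorem continuous_eK (k : ℤ × ℤ) : Continuous (eK k) := by
  unfold eK
  fun_prop

theorem fCoeff_trig (S : Finset (ℤ × ℤ)) (a : ℤ × ℤ → ℂ) (k : ℤ × ℤ) :
    fCoeff (fun x => ∑ q ∈ S, a q * eK q x) k = if k ∈ S then a k else 0 := by
  unfold fCoeff
  have hbox : IsCompact box := isCompact_Icc.prod isCompact_Icc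
  simp only [Finset.sum_mul, mul_assoc]
  rw [integral_finsetSum]
  · simp only [integral_const_mul, int_eK]
    rw [Finset.smul_sum]
    simp only [mul_ite, mul_zero, smul_ite, smul_zero]
    rw [Finset.sum_ite_eq']
    split_ifs
    · have : (π : ℂ) ≠ 0 := by exact_mod_cast Real.pi_ne_zero
      rw [Complex.real_smul]
      push_cast
      field_simp
    · rfl
  · intro q _
    have h1 := continuous_eK q
    have h2 := continuous_eK k
    have h3 : Continuous fun x => a q * (eK q x * (starRingEnd ℂ) (eK k x)) :=
      continuous_const.mul (h1.mul (Complex.continuous_conj.comp h2))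
    exact h3.continuousOn.integrableOn_compact hbox

theorem count_le (N m : ℕ) (hN : Even N) (hNpos : 0 < N) (T : Finset ℤ)
    (hT : ∀ k ∈ T, -((m : ℝ) * N / 2) ≤ (k : ℝ) ∧ (k : ℝ) < (m : ℝ) * N / 2) (q : ℤ) :
    (T.filter (fun k => (N : ℤ) ∣ q - k)).card ≤ m := by
  obtain ⟨h, rfl⟩ := hN
  have hsub : T.filter (fun k => ((h + h : ℕ) : ℤ) ∣ q - k) ⊆
      (Finset.Ico (-((m : ℤ) * h)) ((m : ℤ) * h)).filter
        (fun k => k ≡ q [ZMOD ((h + h : ℕ) : ℤ)]) := by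
    intro k hk
    rw [Finset.mem_filter] at hk ⊢
    obtain ⟨hk, hd⟩ := hk
    obtain ⟨h1, h2⟩ := hT k hk
    refine ⟨?_, Int.modEq_iff_dvd.2 hd⟩
    rw [Finset.mem_Ico]
    push_cast at h1 h2
    constructor
    · have : ((-((m : ℤ) * h) : ℤ) : ℝ) ≤ (k : ℝ) := by push_cast; linarith
      exact_mod_cast this
    · have : (k : ℝ) < (((m : ℤ) * h : ℤ) : ℝ) := by push_cast; linarith
      exact_mod_cast this
  refine (Finset.card_le_card hsub).trans ?_
  have hpos : (0 : ℤ) < ((h + h : ℕ) : ℤ) := by exact_mod_cast hNpos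
  have hc := Int.Ico_filter_modEq_card (-((m : ℤ) * h)) ((m : ℤ) * h) hpos q
  have hh : (((h + h : ℕ) : ℤ) : ℚ) ≠ 0 := by exact_mod_cast hpos.ne'
  have e : ((((m : ℤ) * h : ℤ) : ℚ) - q) / (((h + h : ℕ) : ℤ) : ℚ)
      = (((-((m : ℤ) * h) : ℤ) : ℚ) - q) / (((h + h : ℕ) : ℤ) : ℚ) + (m : ℤ) := by
    field_simp
    push_cast
    ring
  rw [e, Int.ceil_add_intCast] at hc
  simp only [add_sub_cancel_left] at hc
  have : (0 : ℤ) ≤ (m : ℤ) := by positivity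
  rw [max_eq_left this] at hc
  exact_mod_cast hc.le

theorem grid_bound (N m : ℕ) (hN : Even N) (hNpos : 0 < N) (S : Finset (ℤ × ℤ))
    (hS : ∀ k ∈ S, (-((m : ℝ) * N / 2) ≤ (k.1 : ℝ) ∧ (k.1 : ℝ) < (m : ℝ) * N / 2) ∧
      (-((m : ℝ) * N / 2) ≤ (k.2 : ℝ) ∧ (k.2 : ℝ) < (m : ℝ) * N / 2)) (a : ℤ × ℤ → ℂ) :
    ∑ j ∈ gridIdx N, ∑ l ∈ gridIdx N, ‖∑ k ∈ S, a k * eK k (gridPt N j l)‖^2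
      ≤ (N : ℝ)^2 * ((m : ℝ)^2 * ∑ k ∈ S, ‖a k‖^2) := by
  classical
  let R : ℤ × ℤ → ℤ × ℤ → Prop := fun k q => (N : ℤ) ∣ k.1 - q.1 ∧ (N : ℤ) ∣ k.2 - q.2
  have hRs : ∀ k q, R k q ↔ R q k := by
    intro k q
    simp only [R]
    rw [dvd_sub_comm, dvd_sub_comm (c := q.2)]
  have key : ((∑ j ∈ gridIdx N, ∑ l ∈ gridIdx N,
      ‖∑ k ∈ S, a k * eK k (gridPt N j l)‖^2 : ℝ) : ℂ)
      = ∑ k ∈ S, ∑ q ∈ S, a k * (starRingEnd ℂ) (a q) * (if R k q then (N : ℂ)^2 else 0) := by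
    have h1 : ∀ j l : ℤ, ((‖∑ k ∈ S, a k * eK k (gridPt N j l)‖^2 : ℝ) : ℂ)
        = ∑ k ∈ S, ∑ q ∈ S, a k * (starRingEnd ℂ) (a q) *
          (Complex.exp (Complex.I * (((k.1 - q.1 : ℤ) : ℂ) * ((2*π*(j : ℝ)/(N : ℝ) : ℝ) : ℂ))) *
          Complex.exp (Complex.I * (((k.2 - q.2 : ℤ) : ℂ) * ((2*π*(l : ℝ)/(N : ℝ) : ℝ) : ℂ)))) := by
      intro j l
      push_cast
      rw [← Complex.mul_conj', map_sum, Finset.sum_mul_sum]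
      refine Finset.sum_congr rfl fun k _ => Finset.sum_congr rfl fun q _ => ?_
      have := eK_mul_conj k q (gridPt N j l)
      simp only [gridPt] at this ⊢
      push_cast at this ⊢
      rw [← this, map_mul]
      ring
    rw [Complex.ofReal_sum]
    simp only [Complex.ofReal_sum (gridIdx N)]
    simp only [h1]
    have h2 : ∀ j : ℤ, ∀ F : ℤ → ℤ × ℤ → ℤ × ℤ → ℂ,
        ∑ l ∈ gridIdx N, ∑ k ∈ S, ∑ q ∈ S, F l k q = ∑ k ∈ S, ∑ q ∈ S, ∑ l ∈ gridIdx N, F l k q := by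
      intro _ F
      rw [Finset.sum_comm]
      exact Finset.sum_congr rfl fun k _ => Finset.sum_comm
    simp only [h2 0]
    refine Finset.sum_congr rfl fun k _ => Finset.sum_congr rfl fun q _ => ?_
    simp only [← Finset.mul_sum]
    rw [← Finset.sum_mul, grid_sum N hN hNpos, grid_sum N hN hNpos]
    simp only [R]
    congr 1
    split_ifs <;> first | (exfalso; tauto) | ring1
  have hnn : 0 ≤ ∑ j ∈ gridIdx N, ∑ l ∈ gridIdx N, ‖∑ k ∈ S, a k * eK k (gridPt N j l)‖^2 := by
    positivity
  have hle1 : ∑ j ∈ gridIdx N, ∑ l ∈ gridIdx N, ‖∑ k ∈ S, a k * eK k (gridPt N j l)‖^2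
      ≤ ∑ k ∈ S, ∑ q ∈ S, ‖a k‖ * ‖a q‖ * (if R k q then (N : ℝ)^2 else 0) := by
    have h3 := congrArg norm key
    rw [Complex.norm_real, Real.norm_of_nonneg hnn] at h3
    rw [h3]
    refine (norm_sum_le _ _).trans (Finset.sum_le_sum fun k _ => ?_)
    refine (norm_sum_le _ _).trans (Finset.sum_le_sum fun q _ => ?_)
    rw [norm_mul, norm_mul, RCLike.norm_conj]
    split_ifs <;> simp
  have hcard : ∀ k : ℤ × ℤ, ((S.filter (fun q => R k q)).card : ℝ) ≤ (m : ℝ)^2 := by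
    intro k
    have hsub : S.filter (fun q => R k q) ⊆
        ((S.image Prod.fst).filter (fun x => (N : ℤ) ∣ k.1 - x)) ×ˢ
        ((S.image Prod.snd).filter (fun x => (N : ℤ) ∣ k.2 - x)) := by
      intro q hq
      rw [Finset.mem_filter] at hq
      rw [Finset.mem_product, Finset.mem_filter, Finset.mem_filter]
      exact ⟨⟨Finset.mem_image_of_mem _ hq.1, hq.2.1⟩, ⟨Finset.mem_image_of_mem _ hq.1, hq.2.2⟩⟩
    have h4 := Finset.card_le_card hsub
    rw [Finset.card_product] at h4
    have h5 := count_le N m hN hNpos (S.image Prod.fst) (by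
      intro x hx
      obtain ⟨q, hq, rfl⟩ := Finset.mem_image.1 hx
      exact (hS q hq).1) k.1
    have h6 := count_le N m hN hNpos (S.image Prod.snd) (by
      intro x hx
      obtain ⟨q, hq, rfl⟩ := Finset.mem_image.1 hx
      exact (hS q hq).2) k.2
    have h7 := h4.trans (Nat.mul_le_mul h5 h6)
    rw [pow_two]
    exact_mod_cast h7
  have hrow : ∀ k : ℤ × ℤ, ∑ q ∈ S, (if R k q then (N : ℝ)^2 else 0) ≤ (m : ℝ)^2 * (N : ℝ)^2 := by
    intro k
    rw [← Finset.sum_filter, Finset.sum_const, nsmul_eq_mul]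
    exact mul_le_mul_of_nonneg_right (hcard k) (by positivity)
  have hle2 : ∑ k ∈ S, ∑ q ∈ S, ‖a k‖ * ‖a q‖ * (if R k q then (N : ℝ)^2 else 0)
      ≤ ∑ k ∈ S, ∑ q ∈ S, (‖a k‖^2 / 2 * (if R k q then (N : ℝ)^2 else 0)
        + ‖a q‖^2 / 2 * (if R q k then (N : ℝ)^2 else 0)) := by
    refine Finset.sum_le_sum fun k _ => Finset.sum_le_sum fun q _ => ?_
    have e : (if R q k then (N : ℝ)^2 else 0) = (if R k q then (N : ℝ)^2 else 0) := by
      simp only [hRs q k]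
    rw [e, ← add_mul]
    refine mul_le_mul_of_nonneg_right ?_ (by split_ifs <;> positivity)
    nlinarith [sq_nonneg (‖a k‖ - ‖a q‖)]
  refine hle1.trans (hle2.trans ?_)
  simp only [Finset.sum_add_distrib]
  rw [Finset.sum_comm (f := fun k q => ‖a q‖^2 / 2 * (if R q k then (N : ℝ)^2 else 0))]
  simp only [← Finset.mul_sum]
  have hfin : ∑ k ∈ S, ‖a k‖^2 / 2 * ∑ q ∈ S, (if R k q then (N : ℝ)^2 else 0)
      ≤ ∑ k ∈ S, ‖a k‖^2 / 2 * ((m : ℝ)^2 * (N : ℝ)^2) :=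
    Finset.sum_le_sum fun k _ => mul_le_mul_of_nonneg_left (hrow k) (by positivity)
  rw [← Finset.sum_mul, ← Finset.sum_div] at hfin
  linarith

theorem proj_eq (θ : ℝ) (v : ℝ × ℝ → ℂ) : ∃ S : Finset (ℤ × ℤ),
    (∀ k ∈ S, -θ ^ (-(1:ℝ)/2) ≤ (k.1 : ℝ) ∧ (k.1 : ℝ) < θ ^ (-(1:ℝ)/2) ∧
        -θ ^ (-(1:ℝ)/2) ≤ (k.2 : ℝ) ∧ (k.2 : ℝ) < θ ^ (-(1:ℝ)/2)) ∧
    proj θ v = fun x => ∑ k ∈ S, fCoeff v k * eK k x := by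
  classical
  set r := θ ^ (-(1:ℝ)/2) with hr
  have hfin : {k : ℤ × ℤ | -r ≤ (k.1 : ℝ) ∧ (k.1 : ℝ) < r ∧
      -r ≤ (k.2 : ℝ) ∧ (k.2 : ℝ) < r}.Finite := by
    refine Set.Finite.subset
      ((Set.finite_Icc ⌈-r⌉ ⌈r⌉).prod (Set.finite_Icc ⌈-r⌉ ⌈r⌉)) ?_
    rintro k ⟨h1, h2, h3, h4⟩
    refine ⟨⟨Int.ceil_le.2 h1, ?_⟩, ⟨Int.ceil_le.2 h3, ?_⟩⟩
    · exact_mod_cast h2.le.trans (Int.le_ceil r)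
    · exact_mod_cast h4.le.trans (Int.le_ceil r)
  refine ⟨hfin.toFinset, ?_, ?_⟩
  · intro k hk
    exact hfin.mem_toFinset.1 hk
  · funext x
    unfold proj
    rw [tsum_eq_sum (s := hfin.toFinset)]
    · refine Finset.sum_congr rfl fun k hk => ?_
      exact Set.indicator_of_mem (hfin.mem_toFinset.1 hk) _
    · intro k hk
      exact Set.indicator_of_notMem (fun hh => hk (hfin.mem_toFinset.2 hh)) _

theorem m_le (N : ℕ) (hNpos : 0 < N) (τ : ℝ) (c : ℝ) (hc : 0 < c) (θ : ℝ)
    (hθ : θ = max τ (4 / (N : ℝ)^2)) (m : ℕ) (hm0 : 0 < m)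
    (hm : ∀ m' : ℕ, 0 < m' → (c * θ) ^ (-(1:ℝ)/2) ≤ (m' : ℝ) * (N : ℝ) / 2 → m ≤ m') :
    (m : ℝ) ≤ c ^ (-(1:ℝ)/2) + 1 := by
  have hNr : (0 : ℝ) < N := by exact_mod_cast hNpos
  have hcp : 0 < c ^ (-(1:ℝ)/2) := Real.rpow_pos_of_pos hc _
  obtain ⟨n, rfl⟩ : ∃ n, m = n + 1 := ⟨m - 1, by omega⟩
  rcases Nat.eq_zero_or_pos n with rfl | hn
  · push_cast; linarith
  · have h1 : ¬ ((c * θ) ^ (-(1:ℝ)/2) ≤ (n : ℝ) * (N : ℝ) / 2) := fun hh => by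
      have := hm n hn hh
      omega
    rw [not_le] at h1
    have h4 : (0:ℝ) < 4 / (N : ℝ)^2 := by positivity
    have hθ4 : 4 / (N : ℝ)^2 ≤ θ := hθ ▸ le_max_right _ _
    have hθ0 : 0 < θ := h4.trans_le hθ4
    have h2 : θ ^ (-(1:ℝ)/2) ≤ (N : ℝ) / 2 := by
      have h3 : θ ^ (-(1:ℝ)/2) ≤ (4 / (N : ℝ)^2) ^ (-(1:ℝ)/2) :=
        Real.rpow_le_rpow_of_nonpos h4 hθ4 (by norm_num)
      have h5 : (4 / (N : ℝ)^2) ^ (-(1:ℝ)/2) = (N : ℝ) / 2 := by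
        have : 4 / (N : ℝ)^2 = ((N : ℝ) / 2) ^ (-2 : ℝ) := by
          rw [Real.rpow_neg (by positivity), Real.rpow_two]
          field_simp
          norm_num
        rw [this, ← Real.rpow_mul (by positivity)]
        norm_num
      rwa [h5] at h3
    rw [Real.mul_rpow hc.le hθ0.le] at h1
    have h6 : c ^ (-(1:ℝ)/2) * θ ^ (-(1:ℝ)/2) ≤ c ^ (-(1:ℝ)/2) * ((N : ℝ) / 2) :=
      mul_le_mul_of_nonneg_left h2 hcp.le
    have h7 : (n : ℝ) * ((N : ℝ) / 2) < c ^ (-(1:ℝ)/2) * ((N : ℝ) / 2) := by linarith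
    have h8 := lt_of_mul_lt_mul_right h7 (by positivity)
    push_cast
    linarith

/-- grid samples of frequency-truncated functions are controlled by the `L²` norm. -/
theorem stmt18 (N : ℕ) (hN : Even N) (hNpos : 0 < N) (τ : ℝ) (hτ : τ ∈ Set.Ioc (0:ℝ) 1)
    (c : ℝ) (hc : 0 < c) (θ : ℝ) (hθ : θ = max τ (4 / (N : ℝ)^2)) (m : ℕ)
    (hm : 0 < m ∧ (c * θ) ^ (-(1:ℝ)/2) ≤ (m : ℝ) * (N : ℝ) / 2 ∧
      ∀ m' : ℕ, 0 < m' → (c * θ) ^ (-(1:ℝ)/2) ≤ (m' : ℝ) * (N : ℝ) / 2 → m ≤ m')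
    (v : ℝ × ℝ → ℂ) :
    ((N : ℝ)^2)⁻¹ * ∑ j ∈ gridIdx N, ∑ l ∈ gridIdx N, ‖proj (c * θ) v (gridPt N j l)‖^2
        ≤ (m : ℝ)^2 * ∑' k : ℤ × ℤ, ‖fCoeff (proj (c * θ) v) k‖^2 ∧
      Real.sqrt (((N : ℝ)^2)⁻¹ *
          ∑ j ∈ gridIdx N, ∑ l ∈ gridIdx N, ‖proj (c * θ) v (gridPt N j l)‖^2)
        ≤ (c ^ (-(1:ℝ)/2) + 1) *
            Real.sqrt (∑' k : ℤ × ℤ, ‖fCoeff (proj (c * θ) v) k‖^2) := by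
  obtain ⟨hm0, hm1, hm2⟩ := hm
  obtain ⟨S, hS, hproj⟩ := proj_eq (c * θ) v
  have hNr : (0 : ℝ) < N := by exact_mod_cast hNpos
  have htsum : ∑' k : ℤ × ℤ, ‖fCoeff (proj (c * θ) v) k‖^2 = ∑ k ∈ S, ‖fCoeff v k‖^2 := by
    rw [hproj]
    simp only [fCoeff_trig S (fCoeff v)]
    rw [tsum_eq_sum (s := S)]
    · exact Finset.sum_congr rfl fun k hk => by rw [if_pos hk]
    · intro k hk
      simp [hk]
  have hA : ((N : ℝ)^2)⁻¹ * ∑ j ∈ gridIdx N, ∑ l ∈ gridIdx N,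
      ‖proj (c * θ) v (gridPt N j l)‖^2
        ≤ (m : ℝ)^2 * ∑' k : ℤ × ℤ, ‖fCoeff (proj (c * θ) v) k‖^2 := by
    rw [htsum, hproj, inv_mul_le_iff₀ (by positivity)]
    refine grid_bound N m hN hNpos S (fun k hk => ?_) (fCoeff v)
    obtain ⟨h1, h2, h3, h4⟩ := hS k hk
    exact ⟨⟨by linarith, by linarith⟩, ⟨by linarith, by linarith⟩⟩
  refine ⟨hA, ?_⟩
  refine (Real.sqrt_le_sqrt hA).trans ?_
  rw [Real.sqrt_mul (by positivity), Real.sqrt_sq (by positivity)]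
  exact mul_le_mul_of_nonneg_right (m_le N hNpos τ c hc θ hθ m hm0 hm2) (Real.sqrt_nonneg _)
end NLS
end
end
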